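/- arXiv:1805.00593 — 2 statements merged into one kernel-verified Lean document; each statement's English description precedes it below -/
import Mathlib

section
/- (Proposition 3.1 (ii), time derivative.) Let p ∈ ℝ³, η > 0, x ∈ ℝ³ with x ≠ p, and t > 0 satisfy |x − p| + t < η. Then the function s ↦ v(x,s) is differentiable at s = t with derivative ∂_t v(x,t) = η − (1/(2|x − p|))·{ (|x − p| + t)² + (|x − p| − t)·||x − p| − t| }. -/
open MeasureTheory Real

noncomputable def PsiB (p : EuclideanSpace ℝ (Fin 3)) (η : ℝ)
    (x : EuclideanSpace ℝ (Fin 3)) : ℝ :=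
  if ‖x - p‖ < η then η - ‖x - p‖ else 0

/-- `v(x,t) = (t/(4π)) ∫_{S²} Ψ_B(x + tω) dσ(ω)`, where `σ = volume.toSphere` is the
surface measure on the unit sphere in `ℝ³` (total mass `4π`). -/
noncomputable def waveV (p : EuclideanSpace ℝ (Fin 3)) (η : ℝ)
    (x : EuclideanSpace ℝ (Fin 3)) (t : ℝ) : ℝ :=
  (t / (4 * π)) *
    ∫ ω : Metric.sphere (0 : EuclideanSpace ℝ (Fin 3)) 1,
      PsiB p η (x + t • (ω : EuclideanSpace ℝ (Fin 3)))
      ∂((volume : Measure (EuclideanSpace ℝ (Fin 3))).toSphere)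


lemma gauss_Ioi (n : ℕ) : ∫ x in Set.Ioi (0 : ℝ), x ^ n * exp (-x ^ 2) =
    (1 / 2) * Gamma (((n : ℝ) + 1) / 2) := by
  have := integral_rpow_mul_exp_neg_rpow (p := 2) (q := n) (by norm_num) (by
    have : (0 : ℝ) ≤ n := by positivity
    linarith)
  rw [← this]
  refine setIntegral_congr_fun measurableSet_Ioi fun x hx => ?_
  simp only [rpow_natCast]
  norm_num

lemma gauss_even (n : ℕ) (hn : Even n) : ∫ x : ℝ, x ^ n * exp (-x ^ 2) =
    Gamma (((n : ℝ) + 1) / 2) := by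
  have h := integral_comp_abs (f := fun x => x ^ n * exp (-x ^ 2))
  simp only [sq_abs, hn.pow_abs] at h
  rw [h, gauss_Ioi]; ring

lemma gauss_odd (n : ℕ) (hn : Odd n) : ∫ x : ℝ, x ^ n * exp (-x ^ 2) = 0 := by
  have h := integral_neg_eq_self (fun x : ℝ => x ^ n * exp (-x ^ 2)) volume
  simp only [hn.neg_pow, neg_sq, neg_mul, integral_neg] at h
  linarith

lemma gauss_zero : ∫ x : ℝ, exp (-x ^ 2) = √π := by
  simpa using integral_gaussian 1

abbrev E3 := EuclideanSpace ℝ (Fin 3)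

lemma vol_coord (n : ℕ) : ∫ y : E3, (y 0) ^ n * exp (-‖y‖ ^ 2) =
    (∫ x : ℝ, x ^ n * exp (-x ^ 2)) * π := by
  have h := (PiLp.volume_preserving_toLp (Fin 3)).integral_comp
    (MeasurableEquiv.toLp 2 (Fin 3 → ℝ)).measurableEmbedding
    (fun y : E3 => (y 0) ^ n * exp (-‖y‖ ^ 2))
  rw [← h]
  have h2 := integral_fintype_prod_volume_eq_prod (ι := Fin 3) (E := fun _ => ℝ)
    (fun i x => (if i = 0 then x ^ n else 1) * exp (-x ^ 2))
  simp only [Fin.prod_univ_three] at h2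
  simp [gauss_zero] at h2
  rw [mul_assoc, Real.mul_self_sqrt pi_pos.le] at h2
  rw [← h2]
  congr 1
  ext x
  rw [EuclideanSpace.norm_sq_eq]
  simp only [Fin.sum_univ_three, Real.norm_eq_abs, sq_abs, neg_add, exp_add]
  ring

lemma vol_inner (e : E3) (he : ‖e‖ = 1) (n : ℕ) :
    ∫ y : E3, (inner ℝ e y) ^ n * exp (-‖y‖ ^ 2) =
    (∫ x : ℝ, x ^ n * exp (-x ^ 2)) * π := by
  obtain ⟨b, hb⟩ := Orthonormal.exists_orthonormalBasis_extension_of_card_eq (𝕜 := ℝ) (E := E3)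
    (ι := Fin 3) (by simp) (v := fun _ => e) (s := {0}) (by
      constructor
      · intro i; simpa using he
      · intro i j hij; exact absurd (Subsingleton.elim i j) hij)
  have hb0 : b 0 = e := hb 0 (by simp)
  rw [← vol_coord, ← (b.repr.measurePreserving).integral_comp
    b.repr.toHomeomorph.measurableEmbedding (fun y : E3 => (y 0) ^ n * exp (-‖y‖ ^ 2))]
  congr 1
  ext y
  rw [LinearIsometryEquiv.norm_map, b.repr_apply_apply, hb0]

lemma vol_polar (e : E3) (n : ℕ) :
    ∫ y : E3, (inner ℝ e y) ^ n * exp (-‖y‖ ^ 2) =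
    (∫ ω : Metric.sphere (0 : E3) 1, (inner ℝ e (ω : E3)) ^ n ∂(volume : Measure E3).toSphere) *
      ∫ x in Set.Ioi (0 : ℝ), x ^ (n + 2) * exp (-x ^ 2) := by
  calc _ = ∫ y : ({(0)}ᶜ : Set E3), (inner ℝ e y.1) ^ n * exp (-‖y.1‖ ^ 2) ∂((volume : Measure E3).comap Subtype.val) := by
        rw [integral_subtype_comap (measurableSet_singleton _).compl
          fun y : E3 ↦ (inner ℝ e y) ^ n * exp (-‖y‖ ^ 2), restrict_compl_singleton]
    _ = ∫ z : Metric.sphere (0 : E3) 1 × Set.Ioi (0 : ℝ),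
          (inner ℝ e (z.1 : E3)) ^ n * ((z.2 : ℝ) ^ n * exp (-(z.2 : ℝ) ^ 2))
          ∂(volume.toSphere.prod (.volumeIoiPow (Module.finrank ℝ E3 - 1))) := by
        rw [← (volume : Measure E3).measurePreserving_homeomorphUnitSphereProd.integral_comp
          (Homeomorph.measurableEmbedding _)]
        congr 1
        ext y
        have : ‖y.1‖ ≠ 0 := norm_ne_zero_iff.2 y.2
        simp only [homeomorphUnitSphereProd_apply_fst_coe, homeomorphUnitSphereProd_apply_snd_coe, inner_smul_right, mul_pow, inv_pow]
        field_simp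
    _ = _ := by
        rw [integral_prod_mul (fun ω : Metric.sphere (0 : E3) 1 => (inner ℝ e (ω : E3)) ^ n)
          (fun z : Set.Ioi (0 : ℝ) => (z : ℝ) ^ n * exp (-(z : ℝ) ^ 2))]
        congr 1
        simp only [Measure.volumeIoiPow, ENNReal.ofReal]
        rw [integral_withDensity_eq_integral_smul, integral_subtype_comap measurableSet_Ioi
          (fun z : ℝ => Real.toNNReal (z ^ (Module.finrank ℝ E3 - 1)) • (z ^ n * exp (-z ^ 2)))]
        · refine setIntegral_congr_fun measurableSet_Ioi fun x hx => ?_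
          have : (0 : ℝ) < x := hx
          have h0 : 0 ≤ x ^ 2 := by positivity
          simp [NNReal.smul_def, max_eq_left h0]
          ring
        · exact (measurable_subtype_coe.pow_const _).real_toNNReal

lemma sphere_moment (e : E3) (he : ‖e‖ = 1) (n : ℕ) :
    ∫ ω : Metric.sphere (0 : E3) 1, (inner ℝ e (ω : E3)) ^ n ∂(volume : Measure E3).toSphere
      = 2 * π * ∫ z in (-1 : ℝ)..1, z ^ n := by
  have h := (vol_polar e n).symm.trans (vol_inner e he n)
  rw [gauss_Ioi] at h
  have hn : (0 : ℝ) ≤ n := by positivity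
  have e1 : (((n + 2 : ℕ) : ℝ) + 1) / 2 = ((n : ℝ) + 1) / 2 + 1 := by push_cast; ring
  have hp : 0 < Gamma (((n : ℝ) + 1) / 2) := Gamma_pos_of_pos (by positivity)
  rw [e1, Gamma_add_one (by positivity)] at h
  rw [integral_pow]
  rcases Nat.even_or_odd n with hn | hn
  · rw [gauss_even n hn] at h
    rw [hn.add_one.neg_one_pow]
    rw [one_pow]
    generalize (∫ ω : Metric.sphere (0 : E3) 1, (inner ℝ e (ω : E3)) ^ n ∂(volume : Measure E3).toSphere) = I at *
    field_simp at h ⊢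
    linarith
  · rw [gauss_odd n hn, zero_mul] at h
    rw [hn.add_one.neg_one_pow, one_pow, sub_self, zero_div, mul_zero]
    refine (mul_eq_zero.1 h).resolve_right ?_
    positivity

lemma hatbox (e : E3) (he : ‖e‖ = 1) (f : ℝ → ℝ) (hf : Continuous f) :
    ∫ ω : Metric.sphere (0 : E3) 1, f (inner ℝ e (ω : E3)) ∂(volume : Measure E3).toSphere
      = 2 * π * ∫ z in (-1 : ℝ)..1, f z := by
  have hInt : ∀ g : ℝ → ℝ, Continuous g → Integrable
      (fun ω : Metric.sphere (0 : E3) 1 => g (inner ℝ e (ω : E3))) (volume : Measure E3).toSphere := by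
    intro g hg
    exact (by fun_prop : Continuous fun ω : Metric.sphere (0 : E3) 1 => g (inner ℝ e (ω : E3))).integrable_of_hasCompactSupport
      (HasCompactSupport.of_compactSpace _)
  have hmem : ∀ ω : Metric.sphere (0 : E3) 1, inner ℝ e (ω : E3) ∈ Set.Icc (-1 : ℝ) 1 := by
    intro ω
    have := abs_real_inner_le_norm e (ω : E3)
    rw [he, norm_eq_of_mem_sphere, mul_one] at this
    exact abs_le.1 this
  have hpoly : ∀ P : Polynomial ℝ,
      ∫ ω : Metric.sphere (0 : E3) 1, P.eval (inner ℝ e (ω : E3)) ∂(volume : Measure E3).toSphere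
      = 2 * π * ∫ z in (-1 : ℝ)..1, P.eval z := by
    intro P
    induction P using Polynomial.induction_on' with
    | add p q hp hq =>
      simp only [Polynomial.eval_add]
      rw [integral_add (hInt _ p.continuous) (hInt _ q.continuous), hp, hq,
        intervalIntegral.integral_add (p.continuous.intervalIntegrable _ _)
          (q.continuous.intervalIntegrable _ _)]
      ring
    | monomial n a =>
      simp only [Polynomial.eval_monomial]
      rw [integral_const_mul, sphere_moment e he, intervalIntegral.integral_const_mul]
      ring
  set M := (volume : Measure E3).toSphere.real Set.univ with hM
  have hM0 : 0 ≤ M := measureReal_nonneg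
  refine eq_of_forall_dist_le fun ε hε => ?_
  have hK : 0 < M + 4 * π := by positivity
  obtain ⟨P, hP⟩ := exists_polynomial_near_of_continuousOn (-1) 1 f hf.continuousOn
    (ε / (M + 4 * π)) (by positivity)
  set δ := ε / (M + 4 * π) with hδ
  have h1 : |(∫ ω : Metric.sphere (0 : E3) 1, P.eval (inner ℝ e (ω : E3)) ∂(volume : Measure E3).toSphere)
     - ∫ ω : Metric.sphere (0 : E3) 1, f (inner ℝ e (ω : E3)) ∂(volume : Measure E3).toSphere| ≤ δ * M := by
    rw [← integral_sub (hInt _ P.continuous) (hInt _ hf)]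
    exact norm_integral_le_of_norm_le_const
      (f := fun ω : Metric.sphere (0 : E3) 1 => P.eval (inner ℝ e (ω : E3)) - f (inner ℝ e (ω : E3)))
      (.of_forall fun ω => (hP _ (hmem ω)).le)
  have h2 : |(∫ z in (-1 : ℝ)..1, P.eval z) - ∫ z in (-1 : ℝ)..1, f z| ≤ δ * 2 := by
    rw [← intervalIntegral.integral_sub (P.continuous.intervalIntegrable _ _)
          (hf.intervalIntegrable _ _)]
    have := intervalIntegral.norm_integral_le_of_norm_le_const (a := -1) (b := 1)
      (f := fun z => P.eval z - f z) (C := δ) (fun z hz => (hP z (by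
        rw [Set.uIoc_of_le (by norm_num)] at hz
        exact Set.Ioc_subset_Icc_self hz)).le)
    norm_num at this ⊢
    exact this
  rw [hpoly] at h1
  rw [Real.dist_eq]
  have h3 : δ * M + 2 * π * (δ * 2) = ε := by rw [hδ]; field_simp; ring
  have h4 : 2 * π * |(∫ z in (-1 : ℝ)..1, P.eval z) - ∫ z in (-1 : ℝ)..1, f z| ≤ 2 * π * (δ * 2) := by gcongr
  rw [← abs_of_pos (show 0 < 2 * π by positivity), ← abs_mul, abs_of_pos (show 0 < 2 * π by positivity), mul_sub] at h4
  rw [abs_le] at *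
  constructor <;> linarith [h1.1, h1.2, h4.1, h4.2]

lemma sqrt_int (r s : ℝ) (hr : 0 < r) (hs : 0 < s) :
    ∫ z in (-1 : ℝ)..1, √(2 * r * s * z + (r ^ 2 + s ^ 2)) =
      ((r + s) ^ 3 - |r - s| ^ 3) / (3 * r * s) := by
  rw [intervalIntegral.integral_comp_mul_add (fun u => √u) (by positivity)]
  simp only [Real.sqrt_eq_rpow]
  rw [integral_rpow (by left; norm_num)]
  have a1 : 2 * r * s * 1 + (r ^ 2 + s ^ 2) = |r + s| ^ 2 := by rw [sq_abs]; ring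
  have a2 : 2 * r * s * (-1) + (r ^ 2 + s ^ 2) = |r - s| ^ 2 := by rw [sq_abs]; ring
  have a3 : ∀ x : ℝ, (|x| ^ 2) ^ ((1 / 2 : ℝ) + 1) = |x| ^ 3 := by
    intro x
    rw [← rpow_natCast, ← rpow_mul (abs_nonneg x), ← rpow_natCast]
    norm_num
  rw [a1, a2, a3, a3, abs_of_pos (by positivity : 0 < r + s), smul_eq_mul]
  field_simp
  norm_num


lemma sphere_total : ∫ _ω : Metric.sphere (0 : E3) 1, (1 : ℝ) ∂(volume : Measure E3).toSphere
    = 4 * π := by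
  have h := sphere_moment (EuclideanSpace.single 0 1) (by simp) 0
  simp only [pow_zero] at h
  rw [h]
  norm_num
  ring

lemma waveV_eq (p : E3) (η : ℝ) (x : E3) (hxp : x ≠ p) (s : ℝ) (hs : 0 < s)
    (h : ‖x - p‖ + s < η) :
    waveV p η x s =
      s * η - ((‖x - p‖ + s) ^ 3 - |‖x - p‖ - s| ^ 3) / (6 * ‖x - p‖) := by
  have hr : 0 < ‖x - p‖ := norm_pos_iff.2 (sub_ne_zero.2 hxp)
  set r := ‖x - p‖ with hrdef
  set e : E3 := r⁻¹ • (x - p) with he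
  have hen : ‖e‖ = 1 := by
    rw [he, norm_smul, norm_inv, Real.norm_of_nonneg hr.le, ← hrdef]
    field_simp
  have hnorm : ∀ ω : Metric.sphere (0 : E3) 1, ‖x + s • (ω : E3) - p‖ =
      √(2 * r * s * inner ℝ e (ω : E3) + (r ^ 2 + s ^ 2)) := by
    intro ω
    have h1 : x + s • (ω : E3) - p = (x - p) + s • (ω : E3) := by abel
    have h2 : ‖x + s • (ω : E3) - p‖ ^ 2 =
        2 * r * s * inner ℝ e (ω : E3) + (r ^ 2 + s ^ 2) := by
      rw [h1, norm_add_sq_real, norm_smul, norm_eq_of_mem_sphere, he, real_inner_smul_left,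
        real_inner_smul_right, Real.norm_of_nonneg hs.le, ← hrdef]
      field_simp
      ring
    rw [← h2, Real.sqrt_sq (norm_nonneg _)]
  have hPsi : ∀ ω : Metric.sphere (0 : E3) 1, PsiB p η (x + s • (ω : E3)) =
      η * 1 - √(2 * r * s * inner ℝ e (ω : E3) + (r ^ 2 + s ^ 2)) := by
    intro ω
    have h1 : x + s • (ω : E3) - p = (x - p) + s • (ω : E3) := by abel
    have h2 : ‖x + s • (ω : E3) - p‖ < η := by
      rw [h1]
      refine (norm_add_le _ _).trans_lt ?_
      rwa [norm_smul, norm_eq_of_mem_sphere, Real.norm_of_nonneg hs.le, mul_one]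
    rw [PsiB, if_pos h2, hnorm, mul_one]
  unfold waveV
  simp only [hPsi]
  have hc : Continuous fun ω : Metric.sphere (0 : E3) 1 =>
      √(2 * r * s * inner ℝ e (ω : E3) + (r ^ 2 + s ^ 2)) := by fun_prop
  rw [integral_sub (integrable_const _)
    (hc.integrable_of_hasCompactSupport (HasCompactSupport.of_compactSpace _)),
    integral_const_mul, sphere_total,
    hatbox e hen (fun z => √(2 * r * s * z + (r ^ 2 + s ^ 2))) (by fun_prop),
    sqrt_int r s hr hs]
  field_simp
  ring

lemma abs_cube_deriv (u : ℝ) : HasDerivAt (fun u : ℝ => |u| ^ 3) (3 * |u| * u) u := by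
  have h := hasDerivAt_abs_rpow u (p := 3) (by norm_num)
  norm_num at h
  exact_mod_cast h

/-- Proposition 3.1 (ii), time derivative. -/
theorem stmt_5 (p : EuclideanSpace ℝ (Fin 3)) (η : ℝ) (hη : 0 < η)
    (x : EuclideanSpace ℝ (Fin 3)) (hxp : x ≠ p) (t : ℝ) (ht : 0 < t)
    (h : ‖x - p‖ + t < η) :
    HasDerivAt (fun s => waveV p η x s)
      (η - (1 / (2 * ‖x - p‖)) *
        ((‖x - p‖ + t) ^ 2 + (‖x - p‖ - t) * |‖x - p‖ - t|)) t := by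
  have hr : 0 < ‖x - p‖ := norm_pos_iff.2 (sub_ne_zero.2 hxp)
  have hev : (fun s => waveV p η x s) =ᶠ[nhds t] fun s =>
      s * η - ((‖x - p‖ + s) ^ 3 - |‖x - p‖ - s| ^ 3) / (6 * ‖x - p‖) := by
    filter_upwards [lt_mem_nhds ht, gt_mem_nhds (show t < η - ‖x - p‖ by linarith)] with s h1 h2
    exact waveV_eq p η x hxp s h1 (by linarith)
  refine HasDerivAt.congr_of_eventuallyEq ?_ hev
  have d1 : HasDerivAt (fun s : ℝ => |‖x - p‖ - s| ^ 3)
      (3 * |‖x - p‖ - t| * (‖x - p‖ - t) * (-1)) t :=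
    (abs_cube_deriv (‖x - p‖ - t)).comp t ((hasDerivAt_id t).const_sub _)
  have d2 : HasDerivAt (fun s : ℝ => (‖x - p‖ + s) ^ 3)
      (3 * (‖x - p‖ + t) ^ 2) t := by
    have := ((hasDerivAt_id t).const_add ‖x - p‖).pow 3
    refine HasDerivAt.congr_deriv (f := fun s : ℝ => (‖x - p‖ + s) ^ 3) this ?_
    simp
  refine HasDerivAt.congr_deriv (f := fun s : ℝ =>
      s * η - ((‖x - p‖ + s) ^ 3 - |‖x - p‖ - s| ^ 3) / (6 * ‖x - p‖))
    (((hasDerivAt_id t).mul_const η).sub ((d2.sub d1).div_const (6 * ‖x - p‖))) ?_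
  field_simp
  ring
end

section
/- (Proposition A, j = 1.) Let η > 0, τ > 0, B = {y ∈ ℝ³ : |y| < η}, and x ∈ B with x ≠ 0. Then ∫_B ( e^{−τ|x−y|} / |x−y| ) · |y| dy = (4π/τ²)·( |x| + (2/τ²)·(1 − e^{−τ|x|})/|x| − e^{−τη}·(η² + 2η/τ + 2/τ²)·sinh(τ|x|)/|x| ). -/
open MeasureTheory Real

lemma aux_coord (x : EuclideanSpace ℝ (Fin 3)) (hx0 : x ≠ 0) :
    ∃ Φ : EuclideanSpace ℝ (Fin 3) → ℝ × (ℝ × ℝ), MeasurePreserving Φ volume volume ∧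
      ∀ y, ‖y‖ ^ 2 = (Φ y).1 ^ 2 + ((Φ y).2.1 ^ 2 + (Φ y).2.2 ^ 2) ∧
        ‖x - y‖ ^ 2 = (‖x‖ - (Φ y).1) ^ 2 + ((Φ y).2.1 ^ 2 + (Φ y).2.2 ^ 2) := by
  have ha : ‖x‖ ≠ 0 := norm_ne_zero_iff.2 hx0
  obtain ⟨b, hb⟩ := Orthonormal.exists_orthonormalBasis_extension_of_card_eq (𝕜 := ℝ)
    (E := EuclideanSpace ℝ (Fin 3)) (ι := Fin 3) (by simp)
    (v := fun _ => ‖x‖⁻¹ • x) (s := {0}) (by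
      constructor
      · intro i
        simp [Set.domRestrict, norm_smul, ha]
      · intro i j hij
        exact absurd (Subsingleton.elim i j) hij)
  have hb0 : b 0 = ‖x‖⁻¹ • x := hb 0 rfl
  have hxr : b.repr x = ‖x‖ • EuclideanSpace.single 0 (1 : ℝ) := by
    have : x = ‖x‖ • b 0 := by rw [hb0, smul_smul, mul_inv_cancel₀ ha, one_smul]
    conv_lhs => rw [this]
    rw [map_smul, b.repr_self]
  have h1 := b.measurePreserving_repr
  have h2 := PiLp.volume_preserving_ofLp (Fin 3)
  have h3 := volume_preserving_piFinSuccAbove (fun _ : Fin 3 => ℝ) 0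
  have h4 := (MeasurePreserving.id (volume : Measure ℝ)).prod (volume_preserving_finTwoArrow ℝ)
  refine ⟨_, h4.comp (h3.comp (h2.comp h1)), fun y => ⟨?_, ?_⟩⟩
  · rw [← b.repr.norm_map y, EuclideanSpace.norm_sq_eq, Fin.sum_univ_three]
    simp [MeasurableEquiv.piFinSuccAbove, MeasurableEquiv.finTwoArrow, Fin.insertNthEquiv, add_assoc]
    rfl
  · rw [← b.repr.norm_map (x - y), map_sub, hxr, EuclideanSpace.norm_sq_eq, Fin.sum_univ_three]
    simp [MeasurableEquiv.piFinSuccAbove, MeasurableEquiv.finTwoArrow, Fin.insertNthEquiv, add_assoc]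
    rfl

lemma aux_cyl (h : ℝ → ENNReal) (hh : Measurable h) :
    ∫⁻ p : ℝ × ℝ, h (p.1 ^ 2 + p.2 ^ 2) =
      ∫⁻ ρ in Set.Ioi (0 : ℝ), ENNReal.ofReal (2 * π * ρ) * h (ρ ^ 2) := by
  rw [← lintegral_comp_polarCoord_symm]
  have : ∀ p : ℝ × ℝ, ENNReal.ofReal p.1 • h ((polarCoord.symm p).1 ^ 2 + (polarCoord.symm p).2 ^ 2)
      = ENNReal.ofReal p.1 * h (p.1 ^ 2) := by
    intro p
    have : (p.1 * cos p.2) ^ 2 + (p.1 * sin p.2) ^ 2 = p.1 ^ 2 := by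
      linear_combination p.1 ^ 2 * (sin_sq_add_cos_sq p.2)
    simp [polarCoord_symm_apply, this]
  simp_rw [this]
  rw [polarCoord_target, Measure.volume_eq_prod, ← Measure.prod_restrict, lintegral_prod _ (by fun_prop)]
  refine lintegral_congr fun ρ => ?_
  simp only [lintegral_const, Measure.restrict_apply MeasurableSet.univ, Set.univ_inter,
    Real.volume_Ioo]
  rw [mul_right_comm, ← ENNReal.ofReal_mul' (by linarith [pi_pos])]
  congr 2
  ring

lemma aux_half (f : ℝ × ℝ → ENNReal) (hf : Measurable f) :
    ∫⁻ z : ℝ, ∫⁻ ρ in Set.Ioi (0 : ℝ), f (z, ρ) =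
      ∫⁻ r in Set.Ioi (0 : ℝ), ∫⁻ θ in Set.Ioo 0 π,
        ENNReal.ofReal r * f (r * cos θ, r * sin θ) := by
  have hS : MeasurableSet {p : ℝ × ℝ | 0 < p.2} := measurableSet_lt measurable_const measurable_snd
  have e1 : ∫⁻ z : ℝ, ∫⁻ ρ in Set.Ioi (0 : ℝ), f (z, ρ)
      = ∫⁻ p : ℝ × ℝ, Set.indicator {p : ℝ × ℝ | 0 < p.2} f p := by
    rw [Measure.volume_eq_prod, lintegral_prod _ (hf.indicator hS).aemeasurable]
    refine lintegral_congr fun z => ?_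
    rw [← lintegral_indicator measurableSet_Ioi]
    rfl
  rw [e1, ← lintegral_comp_polarCoord_symm, polarCoord_target, Measure.volume_eq_prod,
    ← Measure.prod_restrict, lintegral_prod]
  · refine setLIntegral_congr_fun measurableSet_Ioi fun r hr => ?_
    have hr : 0 < r := hr
    simp only
    rw [← lintegral_indicator measurableSet_Ioo, ← lintegral_indicator measurableSet_Ioo]
    refine lintegral_congr fun θ => ?_
    simp only [Set.indicator_apply, polarCoord_symm_apply, Set.mem_Ioo, Set.mem_ofPred_eq, smul_eq_mul]
    by_cases h1 : 0 < θ ∧ θ < π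
    · have : 0 < r * sin θ := mul_pos hr (sin_pos_of_pos_of_lt_pi h1.1 h1.2)
      rw [if_pos ⟨by linarith [pi_pos], h1.2⟩, if_pos this, if_pos h1]
    · rw [if_neg h1]
      split_ifs with h2 h3
      · exfalso
        have : θ ≤ 0 := by
          by_contra hc
          exact h1 ⟨by linarith, h2.2⟩
        have := sin_nonpos_of_nonpos_of_neg_pi_le this h2.1.le
        nlinarith
      · simp
      · rfl
  · refine Measurable.aemeasurable ?_
    exact (by fun_prop : Measurable fun p : ℝ × ℝ => ENNReal.ofReal p.1).mul
      ((hf.indicator hS).comp continuous_polarCoord_symm.measurable)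

lemma aux_sph (x : EuclideanSpace ℝ (Fin 3)) (hx0 : x ≠ 0) (g : ℝ × ℝ → ENNReal)
    (hg : Measurable g) :
    ∫⁻ y, g (‖y‖ ^ 2, ‖x - y‖ ^ 2) =
      ∫⁻ r in Set.Ioi (0 : ℝ), ∫⁻ θ in Set.Ioo 0 π,
        ENNReal.ofReal (2 * π * r ^ 2 * sin θ) *
          g (r ^ 2, ‖x‖ ^ 2 + r ^ 2 - 2 * ‖x‖ * r * cos θ) := by
  obtain ⟨Φ, hΦ, hy⟩ := aux_coord x hx0
  rw [lintegral_congr fun y => congrArg g (Prod.ext (hy y).1 (hy y).2 :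
    (‖y‖ ^ 2, ‖x - y‖ ^ 2) = ((Φ y).1 ^ 2 + ((Φ y).2.1 ^ 2 + (Φ y).2.2 ^ 2),
      (‖x‖ - (Φ y).1) ^ 2 + ((Φ y).2.1 ^ 2 + (Φ y).2.2 ^ 2)))]
  rw [hΦ.lintegral_comp (f := fun p : ℝ × (ℝ × ℝ) => g (p.1 ^ 2 + (p.2.1 ^ 2 + p.2.2 ^ 2),
    (‖x‖ - p.1) ^ 2 + (p.2.1 ^ 2 + p.2.2 ^ 2))) (by fun_prop), Measure.volume_eq_prod,
    lintegral_prod _ (by fun_prop)]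
  have : ∀ z : ℝ, ∫⁻ p : ℝ × ℝ, g (z ^ 2 + (p.1 ^ 2 + p.2 ^ 2), (‖x‖ - z) ^ 2 + (p.1 ^ 2 + p.2 ^ 2))
      = ∫⁻ ρ in Set.Ioi (0 : ℝ), ENNReal.ofReal (2 * π * ρ) *
        g (z ^ 2 + ρ ^ 2, (‖x‖ - z) ^ 2 + ρ ^ 2) := fun z =>
    aux_cyl (fun t => g (z ^ 2 + t, (‖x‖ - z) ^ 2 + t)) (by fun_prop)
  simp_rw [this]
  rw [aux_half (fun p => ENNReal.ofReal (2 * π * p.2) *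
        g (p.1 ^ 2 + p.2 ^ 2, (‖x‖ - p.1) ^ 2 + p.2 ^ 2)) (by fun_prop)]
  refine setLIntegral_congr_fun measurableSet_Ioi fun r hr => ?_
  refine lintegral_congr fun θ => ?_
  have hr : 0 < r := hr
  simp only
  rw [← mul_assoc, ← ENNReal.ofReal_mul hr.le]
  congr 2
  · ring
  · congr 1
    · linear_combination r ^ 2 * (sin_sq_add_cos_sq θ)
    · linear_combination r ^ 2 * (sin_sq_add_cos_sq θ)

lemma aux_inner (a r τ : ℝ) (ha : 0 < a) (hr : 0 < r) (hτ : 0 < τ) (hne : r ≠ a) :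
    ∫⁻ θ in Set.Ioo 0 π, ENNReal.ofReal (2 * π * r ^ 2 * sin θ) *
      ENNReal.ofReal (exp (-τ * √(a ^ 2 + r ^ 2 - 2 * a * r * cos θ)) /
        √(a ^ 2 + r ^ 2 - 2 * a * r * cos θ) * √(r ^ 2)) =
    ENNReal.ofReal (2 * π / (a * τ) * (r ^ 2 * (exp (-τ * |a - r|) - exp (-τ * (a + r))))) := by
  have hq : ∀ θ, 0 < a ^ 2 + r ^ 2 - 2 * a * r * cos θ := by
    intro θ
    have h1 : 0 < (a - r) ^ 2 := by
      have : a - r ≠ 0 := fun h => hne (by linarith)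
      positivity
    have h2 : 0 ≤ a * r * (1 - cos θ) :=
      mul_nonneg (by positivity) (by linarith [cos_le_one θ])
    nlinarith
  have hs : ∀ θ, 0 < √(a ^ 2 + r ^ 2 - 2 * a * r * cos θ) := fun θ => sqrt_pos.2 (hq θ)
  have hder : ∀ θ, HasDerivAt (fun θ => -(2 * π * r ^ 2 / (a * τ)) *
      exp (-τ * √(a ^ 2 + r ^ 2 - 2 * a * r * cos θ)))
      (2 * π * r ^ 2 * sin θ * (exp (-τ * √(a ^ 2 + r ^ 2 - 2 * a * r * cos θ)) /
        √(a ^ 2 + r ^ 2 - 2 * a * r * cos θ) * √(r ^ 2))) θ := by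
    intro θ
    have h1 : HasDerivAt (fun θ => a ^ 2 + r ^ 2 - 2 * a * r * cos θ) (2 * a * r * sin θ) θ := by
      have := ((hasDerivAt_cos θ).const_mul (2 * a * r)).const_sub (a ^ 2 + r ^ 2)
      refine this.congr_deriv ?_
      ring
    have h2 := (((h1.sqrt (hq θ).ne').const_mul (-τ)).exp).const_mul (-(2 * π * r ^ 2 / (a * τ)))
    refine h2.congr_deriv ?_
    rw [sqrt_sq hr.le]
    have := (hs θ).ne'
    field_simp
  have hcont : Continuous (fun θ => 2 * π * r ^ 2 * sin θ *
      (exp (-τ * √(a ^ 2 + r ^ 2 - 2 * a * r * cos θ)) /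
        √(a ^ 2 + r ^ 2 - 2 * a * r * cos θ) * √(r ^ 2))) := by
    have := fun θ => (hs θ).ne'
    fun_prop (disch := assumption)
  have hFTC := intervalIntegral.integral_eq_sub_of_hasDerivAt (a := 0) (b := π)
    (fun θ _ => hder θ) (hcont.intervalIntegrable _ _)
  have e1 : √(a ^ 2 + r ^ 2 - 2 * a * r * cos 0) = |a - r| := by
    rw [← sqrt_sq_eq_abs]; congr 1; rw [cos_zero]; ring
  have e2 : √(a ^ 2 + r ^ 2 - 2 * a * r * cos π) = a + r := by
    rw [← sqrt_sq (by positivity : 0 ≤ a + r)]; congr 1; rw [cos_pi]; ring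
  simp only [e1, e2] at hFTC
  rw [intervalIntegral.integral_of_le pi_pos.le, integral_Ioc_eq_integral_Ioo] at hFTC
  have e3 : ∀ θ ∈ Set.Ioo 0 π, ENNReal.ofReal (2 * π * r ^ 2 * sin θ) *
      ENNReal.ofReal (exp (-τ * √(a ^ 2 + r ^ 2 - 2 * a * r * cos θ)) /
        √(a ^ 2 + r ^ 2 - 2 * a * r * cos θ) * √(r ^ 2)) =
      ENNReal.ofReal (2 * π * r ^ 2 * sin θ * (exp (-τ * √(a ^ 2 + r ^ 2 - 2 * a * r * cos θ)) /
        √(a ^ 2 + r ^ 2 - 2 * a * r * cos θ) * √(r ^ 2))) := by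
    intro θ hθ
    rw [ENNReal.ofReal_mul (p := 2 * π * r ^ 2 * sin θ)]
    have := (sin_pos_of_pos_of_lt_pi hθ.1 hθ.2).le
    positivity
  rw [setLIntegral_congr_fun measurableSet_Ioo e3, ← ofReal_integral_eq_lintegral_ofReal, hFTC]
  · congr 1
    ring
  · exact (hcont.integrableOn_Icc (a := 0) (b := π)).mono_set Set.Ioo_subset_Icc_self
  · refine (ae_restrict_iff' measurableSet_Ioo).2 (Filter.Eventually.of_forall fun θ hθ => ?_)
    have := (sin_pos_of_pos_of_lt_pi hθ.1 hθ.2).le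
    simp only [Pi.zero_apply]
    positivity

lemma aux_final (a η τ : ℝ) (ha : 0 < a) (haη : a < η) (hτ : 0 < τ) :
    ∫ r in (0 : ℝ)..η, 2 * π / (a * τ) * (r ^ 2 * (exp (-τ * |a - r|) - exp (-τ * (a + r)))) =
    (4 * π / τ ^ 2) *
        (a + (2 / τ ^ 2) * (1 - Real.exp (-τ * a)) / a
          - Real.exp (-τ * η) * (η ^ 2 + 2 * η / τ + 2 / τ ^ 2) *
              Real.sinh (τ * a) / a) := by
  have hc : Continuous fun r : ℝ =>
    2 * π / (a * τ) * (r ^ 2 * (exp (-τ * |a - r|) - exp (-τ * (a + r)))) := by fun_prop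
  rw [← intervalIntegral.integral_add_adjacent_intervals (b := a)
    (hc.intervalIntegrable _ _) (hc.intervalIntegrable _ _)]
  have dm : ∀ r, HasDerivAt (fun r => exp (-τ * r)) (-τ * exp (-τ * r)) r := fun r => by
    have := ((hasDerivAt_id r).const_mul (-τ)).exp
    refine this.congr_deriv ?_
    simp only [id]; ring
  have dp : ∀ r, HasDerivAt (fun r => exp (τ * r)) (τ * exp (τ * r)) r := fun r => by
    have := ((hasDerivAt_id r).const_mul τ).exp
    refine this.congr_deriv ?_
    simp only [id]; ring
  have p1 : ∀ r, HasDerivAt (fun r : ℝ => r ^ 2 / τ + 2 * r / τ ^ 2 + 2 / τ ^ 3)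
      (2 * r / τ + 2 / τ ^ 2) r := fun r => by
    have := ((((hasDerivAt_id r).pow 2).div_const τ).add
      (((hasDerivAt_id r).const_mul 2).div_const (τ ^ 2))).add_const (2 / τ ^ 3)
    refine this.congr_deriv ?_
    simp
  have p2 : ∀ r, HasDerivAt (fun r : ℝ => r ^ 2 / τ - 2 * r / τ ^ 2 + 2 / τ ^ 3)
      (2 * r / τ - 2 / τ ^ 2) r := fun r => by
    have := ((((hasDerivAt_id r).pow 2).div_const τ).sub
      (((hasDerivAt_id r).const_mul 2).div_const (τ ^ 2))).add_const (2 / τ ^ 3)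
    refine this.congr_deriv ?_
    simp
  have i1 : ∫ r in (0 : ℝ)..a, 2 * π / (a * τ) *
      (r ^ 2 * (exp (-τ * |a - r|) - exp (-τ * (a + r)))) = _ :=
    intervalIntegral.integral_eq_sub_of_hasDerivAt_of_le (a := 0) (b := a) (f := fun r =>
      2 * π / (a * τ) * (exp (-τ * a) * ((r ^ 2 / τ - 2 * r / τ ^ 2 + 2 / τ ^ 3) * exp (τ * r)
        + (r ^ 2 / τ + 2 * r / τ ^ 2 + 2 / τ ^ 3) * exp (-τ * r)))) ha.le (by fun_prop)
      (fun r hr => by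
        have := ((((p2 r).mul (dp r)).add ((p1 r).mul (dm r))).const_mul
          (exp (-τ * a))).const_mul (2 * π / (a * τ))
        refine this.congr_deriv ?_
        rw [abs_of_pos (by linarith [hr.2]),
          show -τ * (a - r) = -τ * a + τ * r by ring, show -τ * (a + r) = -τ * a + -τ * r by ring,
          exp_add, exp_add]
        field_simp
        ring) (hc.intervalIntegrable _ _)
  have i2 : ∫ r in a..η, 2 * π / (a * τ) *
      (r ^ 2 * (exp (-τ * |a - r|) - exp (-τ * (a + r)))) = _ :=
    intervalIntegral.integral_eq_sub_of_hasDerivAt_of_le (a := a) (b := η) (f := fun r =>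
      2 * π / (a * τ) * (-(exp (τ * a) - exp (-τ * a)) *
        ((r ^ 2 / τ + 2 * r / τ ^ 2 + 2 / τ ^ 3) * exp (-τ * r)))) haη.le (by fun_prop)
      (fun r hr => by
        have := (((p1 r).mul (dm r)).const_mul
          (-(exp (τ * a) - exp (-τ * a)))).const_mul (2 * π / (a * τ))
        refine this.congr_deriv ?_
        rw [abs_of_neg (by linarith [hr.1]),
          show -τ * (-(a - r)) = τ * a + -τ * r by ring,
          show -τ * (a + r) = -τ * a + -τ * r by ring, exp_add, exp_add]
        field_simp
        ring) (hc.intervalIntegrable _ _)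
  rw [i1, i2, sinh_eq]
  simp only [mul_zero, exp_zero]
  have hE : exp (τ * a) = (exp (-τ * a))⁻¹ := by rw [← exp_neg]; congr 1; ring
  rw [show -(τ * a) = -τ * a by ring, hE]
  have := (exp_pos (-τ * a)).ne'
  generalize exp (-τ * a) = X at *
  generalize exp (-τ * η) = Y at *
  field_simp
  ring

/-- Proposition A, `j = 1`. -/
theorem stmt_10 (η τ : ℝ) (hη : 0 < η) (hτ : 0 < τ)
    (x : EuclideanSpace ℝ (Fin 3)) (hx : ‖x‖ < η) (hx0 : x ≠ 0) :
    ∫ y in Metric.ball (0 : EuclideanSpace ℝ (Fin 3)) η,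
        Real.exp (-τ * ‖x - y‖) / ‖x - y‖ * ‖y‖
      = (4 * π / τ ^ 2) *
        (‖x‖ + (2 / τ ^ 2) * (1 - Real.exp (-τ * ‖x‖)) / ‖x‖
          - Real.exp (-τ * η) * (η ^ 2 + 2 * η / τ + 2 / τ ^ 2) *
              Real.sinh (τ * ‖x‖) / ‖x‖) := by
  have ha : 0 < ‖x‖ := norm_pos_iff.2 hx0
  rw [← aux_final ‖x‖ η τ ha hx hτ, intervalIntegral.integral_of_le hη.le,
    integral_Ioc_eq_integral_Ioo]
  have hm : Measurable fun y : EuclideanSpace ℝ (Fin 3) =>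
      Real.exp (-τ * ‖x - y‖) / ‖x - y‖ * ‖y‖ := by fun_prop
  rw [integral_eq_lintegral_of_nonneg_ae (Filter.Eventually.of_forall fun y => by
      simp only [Pi.zero_apply]; positivity) hm.aestronglyMeasurable,
    integral_eq_lintegral_of_nonneg_ae
      ((ae_restrict_iff' measurableSet_Ioo).2 (Filter.Eventually.of_forall fun r hr => by
        have hr0 : 0 < r := hr.1
        have : exp (-τ * (‖x‖ + r)) ≤ exp (-τ * |‖x‖ - r|) := by
          apply exp_le_exp.2
          have : |‖x‖ - r| ≤ ‖x‖ + r := abs_le.2 ⟨by linarith, by linarith⟩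
          nlinarith
        have := sub_nonneg.2 this
        simp only [Pi.zero_apply]
        positivity))
      (Continuous.aestronglyMeasurable (by fun_prop))]
  congr 1
  let g : ℝ × ℝ → ENNReal := Set.indicator {p | √p.1 < η}
    (fun p => ENNReal.ofReal (exp (-τ * √p.2) / √p.2 * √p.1))
  have hg : Measurable g := Measurable.indicator (by fun_prop)
    (measurableSet_lt (by fun_prop) (by fun_prop))
  have e1 : ∫⁻ y in Metric.ball (0 : EuclideanSpace ℝ (Fin 3)) η,
      ENNReal.ofReal (Real.exp (-τ * ‖x - y‖) / ‖x - y‖ * ‖y‖)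
      = ∫⁻ y, g (‖y‖ ^ 2, ‖x - y‖ ^ 2) := by
    rw [← lintegral_indicator measurableSet_ball]
    refine lintegral_congr fun y => ?_
    by_cases hy : ‖y‖ < η
    · rw [Set.indicator_of_mem (mem_ball_zero_iff.2 hy)]
      simp [g, hy]
    · rw [Set.indicator_of_notMem (fun h => hy (mem_ball_zero_iff.1 h))]
      simp [g, hy]
  rw [e1, aux_sph x hx0 g hg, ← lintegral_indicator measurableSet_Ioi,
    ← lintegral_indicator measurableSet_Ioo]
  refine lintegral_congr_ae ?_
  have hae : ∀ᵐ r : ℝ, r ≠ ‖x‖ := Measure.ae_ne volume _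
  filter_upwards [hae] with r hne
  by_cases hr : 0 < r
  · by_cases hrη : r < η
    · rw [Set.indicator_of_mem (show r ∈ Set.Ioi 0 from hr),
        Set.indicator_of_mem (show r ∈ Set.Ioo 0 η from ⟨hr, hrη⟩),
        ← aux_inner ‖x‖ r τ ha hr hτ hne]
      refine lintegral_congr fun θ => ?_
      simp [g, sqrt_sq hr.le, hrη]
    · rw [Set.indicator_of_mem (show r ∈ Set.Ioi 0 from hr),
        Set.indicator_of_notMem (fun h => hrη h.2)]
      simp [g, sqrt_sq hr.le, hrη]
  · rw [Set.indicator_of_notMem (show r ∉ Set.Ioi 0 from hr),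
      Set.indicator_of_notMem (show r ∉ Set.Ioo 0 η from fun h => hr h.1)]
end
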